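/- H-reduction inequality for diagrams (Proposition 4.4). Fix a dimension d > 6 and constants 0 < c ≤ C₀, and let τ: ℤ^d → [0,1] satisfy τ(0) = 1, τ(−x) = τ(x), and c(1+|x|)^{2−d} ≤ τ(x) ≤ C₀(1+|x|)^{2−d} for all x ∈ ℤ^d ∖ {0}; write τ(x,y) := τ(y−x). Then there is a constant C < ∞, depending only on d, c, C₀, such that for every diagrammatic graph (G,S,ℓ) with finitely many vertices and edges, and every pair x, y ∈ V(G) ∖ S such that {x,y} is an H-reducible edge of G, one has Diag(G,S,ℓ) ≤ C · Diag(G̃,S,ℓ), where G̃ is the H-reduction of G by {x,y}. -/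

import Mathlib

open scoped Classical

/-- A finite multigraph on a vertex type `V`: a finite vertex set together with
an edge-multiplicity function on unordered pairs, supported on pairs of vertices. -/
structure Multigraph (V : Type) where
  verts : Finset V
  mult : Sym2 V → ℕ
  supp : ∀ e : Sym2 V, mult e ≠ 0 → ∀ v ∈ e, v ∈ verts

namespace Multigraph

variable {V : Type}

/-- The multiset of neighbours of `x`, counted with edge multiplicity. -/
def nbrs (G : Multigraph V) (x : V) : Multiset V :=
  G.verts.val.bind fun u => Multiset.replicate (G.mult s(x, u)) u

/-- The (edge-)degree of a vertex: the number of edges incident to it. -/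
def deg (G : Multigraph V) (x : V) : ℕ := (G.nbrs x).card

/-- Adjacency: `a ≠ b` and at least one edge joins `a` and `b`. -/
def Adj (G : Multigraph V) (a b : V) : Prop := a ≠ b ∧ G.mult s(a, b) ≠ 0

/-- A multigraph is simple if all multiplicities are at most one and there
are no self-loops. -/
def IsSimple (G : Multigraph V) : Prop :=
  (∀ e : Sym2 V, G.mult e ≤ 1) ∧ ∀ v : V, G.mult s(v, v) = 0

/-- Connectivity of a multigraph. -/
def Connected (G : Multigraph V) : Prop :=
  G.verts.Nonempty ∧ ∀ u ∈ G.verts, ∀ v ∈ G.verts, Relation.ReflTransGen G.Adj u v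

/-- The number of edges (counted with multiplicity). -/
def numEdges (G : Multigraph V) : ℕ := ∑ e ∈ G.verts.sym2, G.mult e

end Multigraph

/-- The list of (unordered) edges traversed by a list of vertices. -/
def listEdges {V : Type} (l : List V) : List (Sym2 V) :=
  (l.zip l.tail).map fun p => s(p.1, p.2)

namespace Multigraph

variable {V : Type}

/-- `l` is a (simple) path in `G`: a nonempty list of distinct vertices of `G`
in which consecutive vertices are adjacent. -/
def IsPathList (G : Multigraph V) (l : List V) : Prop :=
  l ≠ [] ∧ l.Nodup ∧ (∀ v ∈ l, v ∈ G.verts) ∧ l.Chain' G.Adj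

/-- `l` is a simple path in `G` from `a` to `b`. -/
def IsPathBetween (G : Multigraph V) (a b : V) (l : List V) : Prop :=
  G.IsPathList l ∧ l.head? = some a ∧ l.getLast? = some b

/-- `x` is 3-connected to `{s₁, s₂, s₃}`: there are three pairwise edge-disjoint
paths from `x` to `s₁`, `s₂` and `s₃` respectively. -/
def ThreeConnFrom (G : Multigraph V) (s₁ s₂ s₃ x : V) : Prop :=
  ∃ l₁ l₂ l₃ : List V,
    G.IsPathBetween x s₁ l₁ ∧ G.IsPathBetween x s₂ l₂ ∧ G.IsPathBetween x s₃ l₃ ∧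
    (listEdges l₁).Disjoint (listEdges l₂) ∧
    (listEdges l₁).Disjoint (listEdges l₃) ∧
    (listEdges l₂).Disjoint (listEdges l₃)

/-- `G` is 3-connected to `{s₁, s₂, s₃}`: every vertex outside `{s₁, s₂, s₃}`
is 3-connected to `{s₁, s₂, s₃}`. -/
def ThreeConnTo (G : Multigraph V) (s₁ s₂ s₃ : V) : Prop :=
  ∀ x ∈ G.verts, x ≠ s₁ → x ≠ s₂ → x ≠ s₃ → G.ThreeConnFrom s₁ s₂ s₃ x

/-- The edge `{x, y}` is H-reducible: `x` and `y` both have degree at least 3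
and are joined by exactly one edge. -/
def HReducible (G : Multigraph V) (x y : V) : Prop :=
  x ∈ G.verts ∧ y ∈ G.verts ∧ x ≠ y ∧ G.mult s(x, y) = 1 ∧
    3 ≤ G.deg x ∧ 3 ≤ G.deg y

/-- `G'` is the H-reduction of `G` by the H-reducible edge `{x, y}`:
if `x` (resp. `y`) has degree `3` it is deleted and its two remaining
neighbours get joined by a new edge `e_{x∖y}` (resp. `e_{y∖x}`); a vertex of
degree at least `4` is kept; if both have degree at least `4`, only the edge
`{x, y}` is deleted. -/
def IsHReductionBy (G : Multigraph V) (x y : V) (G' : Multigraph V) : Prop :=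
  G.HReducible x y ∧
    ((G.deg x = 3 ∧ G.deg y = 3 ∧
        ∃ z₁ z₂ t₁ t₂ : V,
          G.nbrs x = {y, z₁, z₂} ∧ G.nbrs y = {x, t₁, t₂} ∧
          (∀ v : V, v ∈ G'.verts ↔ v ∈ G.verts ∧ v ≠ x ∧ v ≠ y) ∧
          ∀ e : Sym2 V, G'.mult e =
            (if x ∈ e ∨ y ∈ e then 0 else G.mult e)
              + (if e = s(z₁, z₂) then 1 else 0)
              + (if e = s(t₁, t₂) then 1 else 0)) ∨
     (G.deg x = 3 ∧ 4 ≤ G.deg y ∧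
        ∃ z₁ z₂ : V, G.nbrs x = {y, z₁, z₂} ∧
          (∀ v : V, v ∈ G'.verts ↔ v ∈ G.verts ∧ v ≠ x) ∧
          ∀ e : Sym2 V, G'.mult e =
            (if x ∈ e then 0 else G.mult e) + (if e = s(z₁, z₂) then 1 else 0)) ∨
     (G.deg y = 3 ∧ 4 ≤ G.deg x ∧
        ∃ t₁ t₂ : V, G.nbrs y = {x, t₁, t₂} ∧
          (∀ v : V, v ∈ G'.verts ↔ v ∈ G.verts ∧ v ≠ y) ∧
          ∀ e : Sym2 V, G'.mult e =
            (if y ∈ e then 0 else G.mult e) + (if e = s(t₁, t₂) then 1 else 0)) ∨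
     (4 ≤ G.deg x ∧ 4 ≤ G.deg y ∧
        (∀ v : V, v ∈ G'.verts ↔ v ∈ G.verts) ∧
        ∀ e : Sym2 V, G'.mult e = if e = s(x, y) then 0 else G.mult e))

end Multigraph

open scoped ENNReal

/-- The vertex set of the hypercubic lattice `ℤ^d`. -/
abbrev Vtx (d : ℕ) := Fin d → ℤ

/-- The Euclidean norm of a point of `ℤ^d`. -/
noncomputable def znorm {d : ℕ} (x : Vtx d) : ℝ :=
  Real.sqrt (∑ i, ((x i : ℝ)) ^ 2)

/-- The symmetrised two-point function on unordered pairs; for a symmetric `τ`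
this is exactly `τ(x, y) = τ(y − x)`. -/
noncomputable def tauSym {d : ℕ} (τ : Vtx d → ℝ) : Sym2 (Vtx d) → ℝ :=
  Sym2.lift ⟨fun a b => (τ (b - a) + τ (a - b)) / 2, fun a b => by ring⟩

/-- The diagram of a diagrammatic graph `(G, S, ℓ)`: the sum over all labellings
`f` extending `ℓ` of the product of the two-point functions along the edges of
`G`, counted with multiplicity. -/
noncomputable def Multigraph.Diag {V : Type} {d : ℕ} (τ : Vtx d → ℝ)
    (G : Multigraph V) (S : Set V) (ℓ : V → Vtx d) : ℝ≥0∞ :=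
  ∑' f : {f : V → Vtx d // (∀ v ∈ S, f v = ℓ v) ∧ ∀ v, v ∉ G.verts → f v = 0},
    ∏ e ∈ G.verts.sym2, ENNReal.ofReal (tauSym τ (Sym2.map f.1 e)) ^ G.mult e

theorem znorm_eq_norm {d : ℕ} (x : Vtx d) :
    znorm x = ‖(WithLp.toLp 2 (fun i => (x i : ℝ)) : EuclideanSpace ℝ (Fin d))‖ := by
  simp [znorm, EuclideanSpace.norm_eq]

theorem znorm_nonneg {d : ℕ} (x : Vtx d) : 0 ≤ znorm x := Real.sqrt_nonneg _

theorem znorm_zero {d : ℕ} : znorm (0 : Vtx d) = 0 := by simp [znorm]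

theorem znorm_sub_le {d : ℕ} (x y : Vtx d) : znorm (x - y) ≤ znorm x + znorm y := by
  simp only [znorm_eq_norm]
  refine le_of_eq_of_le (congrArg _ ?_) (norm_sub_le _ _)
  ext i
  simp

theorem norm_le_znorm {d : ℕ} (x : Vtx d) : ‖(fun i => (x i : ℝ))‖ ≤ znorm x := by
  refine (pi_norm_le_iff_of_nonneg (znorm_nonneg x)).2 fun i => ?_
  rw [znorm_eq_norm]
  exact PiLp.norm_apply_le (WithLp.toLp 2 (fun i => (x i : ℝ)) : EuclideanSpace ℝ (Fin d)) i

theorem summable_int_norm_rpow (d : ℕ) (r : ℝ) (hr : r < -d) :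
    Summable fun x : Vtx d => ‖(fun i => (x i : ℝ))‖ ^ r := by
  let b := Pi.basisFun ℝ (Fin d)
  let L := Submodule.span ℤ (Set.range b)
  have hrank : Module.finrank ℤ L = d := by
    rw [ZLattice.rank ℝ L]; simp
  have hs := ZLattice.summable_norm_rpow L r (by rw [hrank]; exact hr)
  have hmem (x : Vtx d) : (fun i => (x i : ℝ)) ∈ L := by
    refine (b.mem_span_iff_repr_mem ℤ _).2 fun i => ⟨x i, ?_⟩
    simp [b]
  have hinj : Function.Injective fun x : Vtx d => (⟨fun i => (x i : ℝ), hmem x⟩ : L) := by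
    intro x y h
    ext i
    exact Int.cast_injective (α := ℝ) (congrFun (congrArg Subtype.val h) i)
  refine (hs.comp_injective hinj).congr fun x => ?_
  simp only [Function.comp_apply, Submodule.coe_norm]

theorem summable_one_add_znorm_rpow (d : ℕ) (r : ℝ) (hr : r < -d) :
    Summable fun x : Vtx d => (1 + znorm x) ^ r := by
  refine (summable_int_norm_rpow d r hr).of_norm_bounded_eventually ?_
  refine Set.Finite.subset (Set.finite_singleton 0) fun x hx => ?_
  by_contra h0
  refine hx ?_
  have hpos : 0 < ‖(fun i => (x i : ℝ))‖ := by
    refine norm_pos_iff.2 fun h => h0 ?_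
    ext i
    exact Int.cast_injective (α := ℝ) ((congrFun h i).trans Int.cast_zero.symm)
  have := norm_le_znorm x
  have hz := znorm_nonneg x
  rw [Set.mem_ofPred_eq, Real.norm_of_nonneg (by positivity)]
  exact Real.rpow_le_rpow_of_nonpos hpos (by linarith) (by linarith [(Nat.cast_nonneg d : (0 : ℝ) ≤ d)])

/-- The square root of the two-point function, as an extended nonnegative real. -/
noncomputable def sqrtTau {d : ℕ} (τ : Vtx d → ℝ) (w : Vtx d) : ℝ≥0∞ :=
  ENNReal.ofReal (Real.sqrt (τ w))

theorem sqrtTau_sq {d : ℕ} {τ : Vtx d → ℝ} (h : ∀ w, 0 ≤ τ w) (w : Vtx d) :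
    sqrtTau τ w ^ 2 = ENNReal.ofReal (τ w) := by
  rw [sqrtTau, ← ENNReal.ofReal_pow (Real.sqrt_nonneg _), Real.sq_sqrt (h w)]

theorem exists_tsum_sqrtTau_cube_le (d : ℕ) (hd : 6 < d) (C₀ : ℝ) :
    ∃ B : ℝ≥0∞, B ≠ ⊤ ∧ ∀ τ : Vtx d → ℝ,
      (∀ w, 0 ≤ τ w) → (∀ w, τ w ≤ C₀ * (1 + znorm w) ^ (2 - (d : ℝ))) →
        ∑' w, sqrtTau τ w ^ 3 ≤ B := by
  have hs := ((summable_one_add_znorm_rpow d ((2 - (d : ℝ)) * (1 / 2) * 3) (by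
    have : (6 : ℝ) < d := by exact_mod_cast hd
    linarith)).mul_left (Real.sqrt C₀ ^ 3))
  refine ⟨_, hs.tsum_ofReal_ne_top, fun τ h0 h => ENNReal.tsum_le_tsum fun w => ?_⟩
  rw [sqrtTau, ← ENNReal.ofReal_pow (Real.sqrt_nonneg _)]
  refine ENNReal.ofReal_le_ofReal ?_
  have hz : 0 ≤ 1 + znorm w := by linarith [znorm_nonneg w]
  rw [Real.rpow_mul hz, Real.rpow_mul hz, ← Real.sqrt_eq_rpow]
  have e3 : Real.sqrt ((1 + znorm w) ^ (2 - (d : ℝ))) ^ (3 : ℝ) =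
      Real.sqrt ((1 + znorm w) ^ (2 - (d : ℝ))) ^ 3 := by norm_cast
  rw [e3, ← mul_pow, ← Real.sqrt_mul' _ (Real.rpow_nonneg hz _)]
  gcongr
  exact h w

theorem exists_tau_le_mul_tau_sub (d : ℕ) (hd : 2 < d) (c C₀ : ℝ) (hc : 0 < c) (hC₀ : 0 < C₀) :
    ∃ K : ℝ, ∀ τ : Vtx d → ℝ,
      (∀ w, c * (1 + znorm w) ^ (2 - (d : ℝ)) ≤ τ w) →
      (∀ w, τ w ≤ C₀ * (1 + znorm w) ^ (2 - (d : ℝ))) →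
        ∀ a b, τ a ≤ K * τ (a - b) ∨ τ b ≤ K * τ (a - b) := by
  have hd' : (2 : ℝ) < d := by exact_mod_cast hd
  refine ⟨C₀ / c * (1 / 2) ^ (2 - (d : ℝ)), fun τ hl hu a b => ?_⟩
  have key (u : Vtx d) (h : znorm (a - b) ≤ 2 * znorm u) :
      τ u ≤ C₀ / c * (1 / 2) ^ (2 - (d : ℝ)) * τ (a - b) := by
    have hz := znorm_nonneg (a - b)
    calc τ u ≤ C₀ * (1 + znorm u) ^ (2 - (d : ℝ)) := hu u
      _ ≤ C₀ * (1 / 2 * (1 + znorm (a - b))) ^ (2 - (d : ℝ)) := by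
        refine mul_le_mul_of_nonneg_left ?_ hC₀.le
        exact Real.rpow_le_rpow_of_nonpos (by positivity) (by linarith) (by linarith)
      _ = C₀ / c * (1 / 2) ^ (2 - (d : ℝ)) * (c * (1 + znorm (a - b)) ^ (2 - (d : ℝ))) := by
        rw [Real.mul_rpow (by norm_num) (by positivity)]
        field_simp
      _ ≤ _ := mul_le_mul_of_nonneg_left (hl _) (by positivity)
  have ht := znorm_sub_le a b
  rcases le_total (znorm a) (znorm b) with h | h
  · exact Or.inr (key b (by linarith))
  · exact Or.inl (key a (by linarith))

theorem ENNReal.mul_mul_le_sum_cubes (p q r : ℝ≥0∞) : p * q * r ≤ p ^ 3 + q ^ 3 + r ^ 3 := by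
  have hm : max (max p q) r ^ 3 ≤ p ^ 3 + q ^ 3 + r ^ 3 := by
    rcases max_choice (max p q) r with h | h <;> rw [h]
    · rcases max_choice p q with h | h <;> rw [h]
      · exact le_add_right (le_add_right le_rfl)
      · exact le_add_right (le_add_left le_rfl)
    · exact le_add_left le_rfl
  refine le_trans (le_of_le_of_eq (mul_le_mul' (mul_le_mul' ?_ ?_) ?_) (by ring)) hm
  · exact (le_max_left p q).trans (le_max_left _ r)
  · exact (le_max_right p q).trans (le_max_left _ r)
  · exact le_max_right _ r

theorem ENNReal.mul_le_add_sq (p q : ℝ≥0∞) : p * q ≤ p ^ 2 + q ^ 2 := by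
  rcases le_total p q with h | h
  · exact (mul_le_mul' h le_rfl).trans ((le_add_left le_rfl).trans_eq' (by ring))
  · exact (mul_le_mul' le_rfl h).trans ((le_add_right le_rfl).trans_eq' (by ring))

theorem tsum_two_le {A : Type*} [AddCommGroup A] (U : A → ℝ≥0∞) (hU : ∀ w, U w ≤ 1) (p q : A) :
    ∑' a, U (a - p) ^ 2 * U (a - q) ^ 2 ≤ 2 * ∑' w, U w ^ 3 := by
  have h4 (w : A) : (U w ^ 2) ^ 2 ≤ U w ^ 3 := by
    rw [← pow_mul]; exact pow_le_pow_right_of_le_one' (hU w) (by norm_num)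
  calc ∑' a, U (a - p) ^ 2 * U (a - q) ^ 2
      ≤ ∑' a, (U (a - p) ^ 3 + U (a - q) ^ 3) := ENNReal.tsum_le_tsum fun a =>
        (ENNReal.mul_le_add_sq _ _).trans (add_le_add (h4 _) (h4 _))
    _ = 2 * ∑' w, U w ^ 3 := by
      have hsub (p : A) : ∑' a, U (a - p) ^ 3 = ∑' w, U w ^ 3 :=
        (Equiv.subRight p).tsum_eq fun w => U w ^ 3
      rw [ENNReal.tsum_add, hsub, hsub, two_mul]

theorem tsum_tsum_three_le {A : Type*} [AddCommGroup A] (U : A → ℝ≥0∞) (p q : A) :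
    ∑' b, ∑' a, U (a - b) ^ 2 * U (a - p) ^ 2 * U (b - q) ^ 2 ≤ 3 * (∑' w, U w ^ 3) ^ 2 := by
  have hsub (p : A) : ∑' a, U (a - p) ^ 3 = ∑' w, U w ^ 3 :=
    (Equiv.subRight p).tsum_eq fun w => U w ^ 3
  have hsub' (p : A) : ∑' a, U (p - a) ^ 3 = ∑' w, U w ^ 3 :=
    (Equiv.subLeft p).tsum_eq fun w => U w ^ 3
  calc ∑' b, ∑' a, U (a - b) ^ 2 * U (a - p) ^ 2 * U (b - q) ^ 2
      ≤ ∑' b, ∑' a, (U (a - b) ^ 3 * U (a - p) ^ 3 + U (a - b) ^ 3 * U (b - q) ^ 3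
          + U (a - p) ^ 3 * U (b - q) ^ 3) := by
        refine ENNReal.tsum_le_tsum fun b => ENNReal.tsum_le_tsum fun a => ?_
        simp only [← mul_pow]
        refine le_of_eq_of_le ?_ (ENNReal.mul_mul_le_sum_cubes _ _ _)
        ring
    _ = 3 * (∑' w, U w ^ 3) ^ 2 := by
        simp only [ENNReal.tsum_add]
        have h₁ : ∑' b, ∑' a, U (a - b) ^ 3 * U (a - p) ^ 3 = (∑' w, U w ^ 3) ^ 2 := by
          rw [ENNReal.tsum_comm]
          simp only [ENNReal.tsum_mul_right, hsub', ENNReal.tsum_mul_left, hsub, sq]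
        simp only [h₁, ENNReal.tsum_mul_right, hsub, ENNReal.tsum_mul_left]
        ring

theorem tsum_star_le {A : Type*} [AddCommGroup A] {U : A → ℝ≥0∞} {K : ℝ≥0∞}
    (hU : ∀ w, U w ≤ 1)
    (hK : ∀ a b, U a ^ 2 * U b ^ 2 ≤ K * U (a - b) ^ 2 * (U a ^ 2 + U b ^ 2)) (y p q : A) :
    ∑' a, U (a - y) ^ 2 * U (a - p) ^ 2 * U (a - q) ^ 2 ≤
      4 * K * (∑' w, U w ^ 3) * U (p - q) ^ 2 := by
  have hpq (a : A) : U (a - p) ^ 2 * U (a - q) ^ 2 ≤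
      K * U (p - q) ^ 2 * (U (a - q) ^ 2 + U (a - p) ^ 2) := by
    rw [mul_comm]
    simpa using hK (a - q) (a - p)
  calc ∑' a, U (a - y) ^ 2 * U (a - p) ^ 2 * U (a - q) ^ 2
      ≤ ∑' a, K * U (p - q) ^ 2 *
          (U (a - y) ^ 2 * U (a - q) ^ 2 + U (a - y) ^ 2 * U (a - p) ^ 2) := by
        refine ENNReal.tsum_le_tsum fun a => ?_
        rw [mul_assoc]
        refine (mul_le_mul' le_rfl (hpq a)).trans_eq ?_
        ring
    _ ≤ K * U (p - q) ^ 2 * (2 * (∑' w, U w ^ 3) + 2 * ∑' w, U w ^ 3) := by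
        rw [ENNReal.tsum_mul_left, ENNReal.tsum_add]
        exact mul_le_mul' le_rfl (add_le_add (tsum_two_le U hU y q) (tsum_two_le U hU y p))
    _ = _ := by ring

theorem tsum_double_star_le {A : Type*} [AddCommGroup A] {U : A → ℝ≥0∞} {K : ℝ≥0∞}
    (hK : ∀ a b, U a ^ 2 * U b ^ 2 ≤ K * U (a - b) ^ 2 * (U a ^ 2 + U b ^ 2)) (p q r s : A) :
    ∑' b, (∑' a, U (a - b) ^ 2 * U (a - p) ^ 2 * U (a - q) ^ 2) *
        (U (b - r) ^ 2 * U (b - s) ^ 2) ≤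
      12 * K ^ 2 * (∑' w, U w ^ 3) ^ 2 * (U (p - q) ^ 2 * U (r - s) ^ 2) := by
  have hpq (a p q : A) : U (a - p) ^ 2 * U (a - q) ^ 2 ≤
      K * U (p - q) ^ 2 * (U (a - q) ^ 2 + U (a - p) ^ 2) := by
    rw [mul_comm]
    simpa using hK (a - q) (a - p)
  calc ∑' b, (∑' a, U (a - b) ^ 2 * U (a - p) ^ 2 * U (a - q) ^ 2) *
        (U (b - r) ^ 2 * U (b - s) ^ 2)
      ≤ ∑' b, ∑' a, K ^ 2 * (U (p - q) ^ 2 * U (r - s) ^ 2) *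
          (U (a - b) ^ 2 * U (a - q) ^ 2 * U (b - s) ^ 2 +
            U (a - b) ^ 2 * U (a - q) ^ 2 * U (b - r) ^ 2 +
            U (a - b) ^ 2 * U (a - p) ^ 2 * U (b - s) ^ 2 +
            U (a - b) ^ 2 * U (a - p) ^ 2 * U (b - r) ^ 2) := by
        refine ENNReal.tsum_le_tsum fun b => ?_
        rw [← ENNReal.tsum_mul_right]
        refine ENNReal.tsum_le_tsum fun a => ?_
        rw [mul_assoc (U (a - b) ^ 2)]
        refine (mul_le_mul' (mul_le_mul' le_rfl (hpq a p q)) (hpq b r s)).trans_eq ?_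
        ring
    _ ≤ K ^ 2 * (U (p - q) ^ 2 * U (r - s) ^ 2) *
          (3 * (∑' w, U w ^ 3) ^ 2 + 3 * (∑' w, U w ^ 3) ^ 2 + 3 * (∑' w, U w ^ 3) ^ 2 +
            3 * (∑' w, U w ^ 3) ^ 2) := by
        simp only [ENNReal.tsum_mul_left, ENNReal.tsum_add]
        refine mul_le_mul' le_rfl (add_le_add (add_le_add (add_le_add ?_ ?_) ?_) ?_) <;>
          exact tsum_tsum_three_le U _ _
    _ = _ := by ring

namespace Multigraph

variable {V : Type}

/-- The multigraph obtained by deleting a vertex together with its incident edges. -/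
noncomputable def eraseVertex (G : Multigraph V) (x : V) : Multigraph V where
  verts := G.verts.erase x
  mult e := if x ∈ e then 0 else G.mult e
  supp e he v hv := by
    have hx : x ∉ e := fun h => he (if_pos h)
    rw [if_neg hx] at he
    exact Finset.mem_erase.2 ⟨fun h => hx (h ▸ hv), G.supp e he v hv⟩

theorem count_nbrs (G : Multigraph V) (x u : V) : (G.nbrs x).count u = G.mult s(x, u) := by
  rw [nbrs, Multiset.count_bind]
  simp only [Multiset.count_replicate]
  change ∑ b ∈ G.verts, _ = _
  rw [Finset.sum_ite_eq' G.verts u]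
  split_ifs with h
  · rfl
  · by_contra h0
    exact h (G.supp _ (Ne.symm h0) u (Sym2.mem_mk_right x u))

theorem mult_ne_zero_of_mem_nbrs {G : Multigraph V} {x u : V} (h : u ∈ G.nbrs x) :
    G.mult s(x, u) ≠ 0 := by
  rw [← count_nbrs]
  exact (Multiset.count_pos.2 h).ne'

theorem mem_verts_of_mem_nbrs {G : Multigraph V} {x u : V} (h : u ∈ G.nbrs x) : u ∈ G.verts :=
  G.supp _ (mult_ne_zero_of_mem_nbrs h) u (Sym2.mem_mk_right x u)

theorem nbrs_eraseVertex (G : Multigraph V) {x y : V} (hxy : x ≠ y) :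
    (G.eraseVertex x).nbrs y = (G.nbrs y).filter (x ≠ ·) := by
  ext u
  rw [count_nbrs, Multiset.count_filter, count_nbrs]
  simp only [eraseVertex, Sym2.mem_iff, hxy, false_or]
  split_ifs <;> simp_all

/-- The product of an edge weight over all edges, counted with multiplicity. -/
noncomputable def weight (G : Multigraph V) (w : Sym2 V → ℝ≥0∞) : ℝ≥0∞ :=
  ∏ e ∈ G.verts.sym2, w e ^ G.mult e

theorem weight_congr (G : Multigraph V) {w w' : Sym2 V → ℝ≥0∞}
    (h : ∀ e ∈ G.verts.sym2, w e = w' e) : G.weight w = G.weight w' :=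
  Finset.prod_congr rfl fun e he => by rw [h e he]

theorem weight_eq_eraseVertex_mul (G : Multigraph V) {x : V} (hx : x ∈ G.verts)
    (w : Sym2 V → ℝ≥0∞) :
    G.weight w = (G.eraseVertex x).weight w * ((G.nbrs x).map fun u => w s(x, u)).prod := by
  have hsplit : G.verts.sym2 =
      (G.verts.erase x).sym2 ∪ G.verts.image fun u => s(x, u) := by
    conv_lhs => rw [← Finset.insert_erase hx]
    rw [Finset.sym2_insert, Finset.insert_erase hx, Finset.union_comm]
  have hnot : ∀ e ∈ (G.verts.erase x).sym2, x ∉ e := fun e he hxe =>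
    Finset.notMem_erase x G.verts (Finset.mem_sym2_iff.1 he x hxe)
  have hdisj : Disjoint (G.verts.erase x).sym2 (G.verts.image fun u => s(x, u)) := by
    refine Finset.disjoint_left.2 fun e he he' => hnot e he ?_
    obtain ⟨u, -, rfl⟩ := Finset.mem_image.1 he'
    exact Sym2.mem_mk_left x u
  rw [weight, hsplit, Finset.prod_union hdisj]
  congr 1
  · refine Finset.prod_congr rfl fun e he => ?_
    simp [eraseVertex, hnot e he]
  · rw [Finset.prod_image fun a _ b _ h => Sym2.congr_right.1 h, nbrs, Multiset.map_bind,
      Multiset.prod_bind]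
    simp only [Multiset.map_replicate, Multiset.prod_replicate]
    rfl

theorem prod_pow_add_edge {W : Finset V} {a b : V} (ha : a ∈ W) (hb : b ∈ W)
    (m : Sym2 V → ℕ) (w : Sym2 V → ℝ≥0∞) :
    ∏ e ∈ W.sym2, w e ^ (m e + if e = s(a, b) then 1 else 0) =
      (∏ e ∈ W.sym2, w e ^ m e) * w s(a, b) := by
  simp only [pow_add, Finset.prod_mul_distrib, pow_ite, pow_one, pow_zero]
  rw [Finset.prod_ite_eq' W.sym2, if_pos (Finset.mk_mem_sym2_iff.2 ⟨ha, hb⟩)]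

/-- The labellings of the vertices in `W` which extend `ℓ`, with value `0` outside `W`. -/
abbrev Labelling {d : ℕ} (W : Finset V) (S : Set V) (ℓ : V → Vtx d) :=
  {f : V → Vtx d // (∀ v ∈ S, f v = ℓ v) ∧ ∀ v, v ∉ W → f v = 0}

theorem tsum_labelling_le {d : ℕ} (W : Finset V) {S : Set V} (ℓ : V → Vtx d) {x : V}
    (hx : x ∉ S) (F : (V → Vtx d) → ℝ≥0∞) :
    ∑' f : Labelling W S ℓ, F f.1 ≤
      ∑' g : Labelling (W.erase x) S ℓ, ∑' a, F (Function.update g.1 x a) := by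
  let φ : Labelling W S ℓ → Labelling (W.erase x) S ℓ × Vtx d := fun f =>
    (⟨Function.update f.1 x 0, fun v hv => by
        rw [Function.update_of_ne (ne_of_mem_of_not_mem hv hx), f.2.1 v hv], fun v hv => by
        by_cases h : v = x
        · rw [h, Function.update_self]
        · rw [Function.update_of_ne h]
          exact f.2.2 v fun hW => hv (Finset.mem_erase.2 ⟨h, hW⟩)⟩, f.1 x)
  have hφ (f : Labelling W S ℓ) : Function.update (φ f).1.1 x (φ f).2 = f.1 := by simp [φ]
  have hinj : Function.Injective φ := fun f f' h =>
    Subtype.ext (by rw [← hφ f, ← hφ f', h])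
  rw [← ENNReal.tsum_prod]
  refine le_of_eq_of_le (tsum_congr fun f => ?_) (ENNReal.tsum_comp_le_tsum_of_injective hinj
    fun p : Labelling (W.erase x) S ℓ × Vtx d => F (Function.update p.1.1 x p.2))
  rw [hφ f]

/-- The weight of an edge under a labelling of its endpoints. -/
noncomputable def edgeWeight {d : ℕ} (τ : Vtx d → ℝ) (f : V → Vtx d) (e : Sym2 V) : ℝ≥0∞ :=
  ENNReal.ofReal (tauSym τ (Sym2.map f e))

theorem diag_eq {d : ℕ} (τ : Vtx d → ℝ) (G : Multigraph V) (S : Set V) (ℓ : V → Vtx d) :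
    Diag τ G S ℓ = ∑' f : Labelling G.verts S ℓ, G.weight (edgeWeight τ f.1) := rfl

theorem edgeWeight_mk {d : ℕ} {τ : Vtx d → ℝ} (h0 : ∀ w, 0 ≤ τ w) (hs : ∀ w, τ (-w) = τ w)
    (f : V → Vtx d) (u v : V) : edgeWeight τ f s(u, v) = sqrtTau τ (f u - f v) ^ 2 := by
  have h := hs (f u - f v)
  rw [neg_sub] at h
  rw [sqrtTau_sq h0, edgeWeight, Sym2.map_mk, tauSym, Sym2.lift_mk]
  simp only [h]
  congr 1
  ring

theorem weight_eraseVertex_update {d : ℕ} (τ : Vtx d → ℝ) (G : Multigraph V) (x : V)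
    (g : V → Vtx d) (a : Vtx d) :
    (G.eraseVertex x).weight (edgeWeight τ (Function.update g x a)) =
      (G.eraseVertex x).weight (edgeWeight τ g) := by
  refine weight_congr _ fun e he => ?_
  rw [edgeWeight, edgeWeight]
  congr 2
  refine Sym2.map_congr fun v hv => ?_
  have := Finset.mem_erase.1 (Finset.mem_sym2_iff.1 he v hv)
  exact Function.update_of_ne this.1 _ _

theorem diag_le_tsum_eraseVertex {d : ℕ} {τ : Vtx d → ℝ} (h0 : ∀ w, 0 ≤ τ w)
    (hs : ∀ w, τ (-w) = τ w) (G : Multigraph V) {S : Set V} (ℓ : V → Vtx d)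
    {x y z₁ z₂ : V} (hxV : x ∈ G.verts) (hx : x ∉ S) (hn : G.nbrs x = {y, z₁, z₂})
    (hloop : G.mult s(x, x) = 0) :
    Diag τ G S ℓ ≤ ∑' g : Labelling (G.eraseVertex x).verts S ℓ,
      (G.eraseVertex x).weight (edgeWeight τ g.1) *
        ∑' a, sqrtTau τ (a - g.1 y) ^ 2 * sqrtTau τ (a - g.1 z₁) ^ 2 *
          sqrtTau τ (a - g.1 z₂) ^ 2 := by
  have hne {u : V} (hu : u ∈ G.nbrs x) : u ≠ x := by
    rintro rfl
    exact mult_ne_zero_of_mem_nbrs hu hloop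
  have hy : y ≠ x := hne (by simp [hn])
  have hz₁ : z₁ ≠ x := hne (by simp [hn])
  have hz₂ : z₂ ≠ x := hne (by simp [hn])
  rw [diag_eq]
  refine (tsum_labelling_le _ ℓ hx fun f => G.weight (edgeWeight τ f)).trans (le_of_eq ?_)
  refine tsum_congr fun g => ?_
  rw [← ENNReal.tsum_mul_left]
  refine tsum_congr fun a => ?_
  rw [weight_eq_eraseVertex_mul G hxV, weight_eraseVertex_update, hn]
  simp [edgeWeight_mk h0 hs, hy, hz₁, hz₂, mul_assoc]

end Multigraph

namespace Multigraph

variable {V : Type}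

theorem diag_le_of_edge_removed {d : ℕ} {τ : Vtx d → ℝ} (h0 : ∀ w, 0 ≤ τ w)
    (hs : ∀ w, τ (-w) = τ w) (hU : ∀ w, sqrtTau τ w ≤ 1) {G G' : Multigraph V} (S : Set V)
    (ℓ : V → Vtx d) {x y : V} (hverts : ∀ v, v ∈ G'.verts ↔ v ∈ G.verts)
    (hmult : ∀ e, G'.mult e = if e = s(x, y) then 0 else G.mult e) :
    Diag τ G S ℓ ≤ Diag τ G' S ℓ := by
  obtain ⟨W', m', hsupp⟩ := G'
  obtain rfl : W' = G.verts := Finset.ext hverts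
  rw [diag_eq, diag_eq]
  refine ENNReal.tsum_le_tsum fun f => Finset.prod_le_prod' fun e _ => ?_
  have hle : edgeWeight τ f.1 e ≤ 1 := by
    induction e with
    | _ u v =>
      rw [edgeWeight_mk h0 hs]
      exact pow_le_one' (hU _) 2
  refine pow_le_pow_right_of_le_one' hle ?_
  have := hmult e
  split_ifs at this <;> simp_all

theorem diag_le_of_vertex_erased {d : ℕ} {τ : Vtx d → ℝ} {K : ℝ≥0∞} (h0 : ∀ w, 0 ≤ τ w)
    (hs : ∀ w, τ (-w) = τ w) (hU : ∀ w, sqrtTau τ w ≤ 1)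
    (hK : ∀ a b, sqrtTau τ a ^ 2 * sqrtTau τ b ^ 2 ≤
      K * sqrtTau τ (a - b) ^ 2 * (sqrtTau τ a ^ 2 + sqrtTau τ b ^ 2))
    {G G' : Multigraph V} {S : Set V} (ℓ : V → Vtx d) {x y z₁ z₂ : V} (hxV : x ∈ G.verts)
    (hx : x ∉ S) (hloop : G.mult s(x, x) = 0) (hn : G.nbrs x = {y, z₁, z₂})
    (hverts : ∀ v, v ∈ G'.verts ↔ v ∈ G.verts ∧ v ≠ x)
    (hmult : ∀ e, G'.mult e =
      (if x ∈ e then 0 else G.mult e) + (if e = s(z₁, z₂) then 1 else 0)) :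
    Diag τ G S ℓ ≤ 4 * K * (∑' w, sqrtTau τ w ^ 3) * Diag τ G' S ℓ := by
  have hz {u : V} (hu : u ∈ G.nbrs x) : u ∈ (G.eraseVertex x).verts := by
    refine Finset.mem_erase.2 ⟨?_, mem_verts_of_mem_nbrs hu⟩
    rintro rfl
    exact mult_ne_zero_of_mem_nbrs hu hloop
  have hz₁ := hz (u := z₁) (by simp [hn])
  have hz₂ := hz (u := z₂) (by simp [hn])
  obtain ⟨W', m', hsupp⟩ := G'
  obtain rfl : W' = (G.eraseVertex x).verts := by
    ext v
    rw [hverts v, eraseVertex, Finset.mem_erase, and_comm]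
  obtain rfl : m' = fun e => (G.eraseVertex x).mult e + if e = s(z₁, z₂) then 1 else 0 :=
    funext hmult
  refine (diag_le_tsum_eraseVertex h0 hs G ℓ hxV hx hn hloop).trans ?_
  rw [diag_eq, ← ENNReal.tsum_mul_left]
  refine ENNReal.tsum_le_tsum fun g => ?_
  rw [weight, weight, prod_pow_add_edge hz₁ hz₂, edgeWeight_mk h0 hs]
  refine (mul_le_mul' le_rfl (tsum_star_le hU hK _ _ _)).trans_eq ?_
  ring

theorem diag_le_of_two_vertices_erased {d : ℕ} {τ : Vtx d → ℝ} {K : ℝ≥0∞} (h0 : ∀ w, 0 ≤ τ w)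
    (hs : ∀ w, τ (-w) = τ w)
    (hK : ∀ a b, sqrtTau τ a ^ 2 * sqrtTau τ b ^ 2 ≤
      K * sqrtTau τ (a - b) ^ 2 * (sqrtTau τ a ^ 2 + sqrtTau τ b ^ 2))
    {G G' : Multigraph V} {S : Set V} (ℓ : V → Vtx d) {x y z₁ z₂ t₁ t₂ : V}
    (hxV : x ∈ G.verts) (hyV : y ∈ G.verts) (hx : x ∉ S) (hy : y ∉ S) (hxy : x ≠ y)
    (hone : G.mult s(x, y) = 1) (hloop : ∀ v, G.mult s(v, v) = 0)
    (hnx : G.nbrs x = {y, z₁, z₂}) (hny : G.nbrs y = {x, t₁, t₂})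
    (hverts : ∀ v, v ∈ G'.verts ↔ v ∈ G.verts ∧ v ≠ x ∧ v ≠ y)
    (hmult : ∀ e, G'.mult e = (if x ∈ e ∨ y ∈ e then 0 else G.mult e)
      + (if e = s(z₁, z₂) then 1 else 0) + (if e = s(t₁, t₂) then 1 else 0)) :
    Diag τ G S ℓ ≤ 12 * K ^ 2 * (∑' w, sqrtTau τ w ^ 3) ^ 2 * Diag τ G' S ℓ := by
  have hcx : (G.nbrs x).count y = 1 := by rw [count_nbrs, hone]
  have hcy : (G.nbrs y).count x = 1 := by rw [count_nbrs, Sym2.eq_swap, hone]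
  have hx0 : (G.nbrs x).count x = 0 := by rw [count_nbrs, hloop]
  have hy0 : (G.nbrs y).count y = 0 := by rw [count_nbrs, hloop]
  have hzV : ∀ u ∈ G.nbrs x, u ∈ G.verts := fun u => mem_verts_of_mem_nbrs
  have htV : ∀ u ∈ G.nbrs y, u ∈ G.verts := fun u => mem_verts_of_mem_nbrs
  rw [hnx] at hcx hx0 hzV
  rw [hny] at hcy hy0 htV
  simp [hxy] at hcx hx0 hcy hy0 hzV htV
  set H := (G.eraseVertex x).eraseVertex y with hH
  have hmem (v : V) : v ∈ H.verts ↔ v ∈ G.verts ∧ v ≠ x ∧ v ≠ y := by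
    simp only [hH, eraseVertex, Finset.mem_erase]
    tauto
  have hz₁ : z₁ ∈ H.verts := (hmem _).2 ⟨by tauto, by tauto, by tauto⟩
  have hz₂ : z₂ ∈ H.verts := (hmem _).2 ⟨by tauto, by tauto, by tauto⟩
  have ht₁ : t₁ ∈ H.verts := (hmem _).2 ⟨by tauto, by tauto, by tauto⟩
  have ht₂ : t₂ ∈ H.verts := (hmem _).2 ⟨by tauto, by tauto, by tauto⟩
  have hny' : (G.eraseVertex x).nbrs y = {t₁, t₂} := by
    simp [nbrs_eraseVertex G hxy, hny, Multiset.filter_singleton, hcy]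
  obtain ⟨W', m', hsupp⟩ := G'
  obtain rfl : W' = H.verts := by
    ext v
    rw [hverts v, hmem]
  obtain rfl : m' = fun e => H.mult e + (if e = s(z₁, z₂) then 1 else 0) +
      if e = s(t₁, t₂) then 1 else 0 := by
    funext e
    refine (hmult e).trans ?_
    congr 2
    simp only [hH, eraseVertex]
    split_ifs <;> tauto
  refine (diag_le_tsum_eraseVertex h0 hs G ℓ hxV hx hnx (hloop x)).trans ?_
  refine (tsum_labelling_le _ ℓ hy fun f => (G.eraseVertex x).weight (edgeWeight τ f) *
    ∑' a, sqrtTau τ (a - f y) ^ 2 * sqrtTau τ (a - f z₁) ^ 2 * sqrtTau τ (a - f z₂) ^ 2).trans ?_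
  rw [diag_eq, ← ENNReal.tsum_mul_left]
  refine ENNReal.tsum_le_tsum fun g => ?_
  rw [weight, prod_pow_add_edge ht₁ ht₂, prod_pow_add_edge hz₁ hz₂]
  have hyV' : y ∈ (G.eraseVertex x).verts := Finset.mem_erase.2 ⟨hxy.symm, hyV⟩
  have hne {u : V} (hu : u ∈ H.verts) : u ≠ y := ((hmem u).1 hu).2.2
  calc _ = H.weight (edgeWeight τ g.1) * ∑' b, (∑' a, sqrtTau τ (a - b) ^ 2 *
          sqrtTau τ (a - g.1 z₁) ^ 2 * sqrtTau τ (a - g.1 z₂) ^ 2) *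
            (sqrtTau τ (b - g.1 t₁) ^ 2 * sqrtTau τ (b - g.1 t₂) ^ 2) := by
        rw [← ENNReal.tsum_mul_left]
        refine tsum_congr fun b => ?_
        rw [weight_eq_eraseVertex_mul _ hyV', weight_eraseVertex_update, hny', ← hH]
        simp only [Multiset.insert_eq_cons, Multiset.map_cons, Multiset.map_singleton,
          Multiset.prod_cons, Multiset.prod_singleton, edgeWeight_mk h0 hs,
          Function.update_self, Function.update_of_ne (hne hz₁), Function.update_of_ne (hne hz₂),
          Function.update_of_ne (hne ht₁), Function.update_of_ne (hne ht₂)]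
        ring
    _ ≤ _ := by
        refine (mul_le_mul' le_rfl (tsum_double_star_le hK _ _ _ _)).trans_eq ?_
        rw [edgeWeight_mk h0 hs, edgeWeight_mk h0 hs, weight]
        ring

end Multigraph

/-- **H-reduction inequality for diagrams** (Proposition 4.4).
For `d > 6` and a two-point function `τ` with the standard two-sided power-law
bounds, there is a constant `C = C(d, c, C₀)` such that for every diagrammatic
graph `(G, S, ℓ)` (a finite multigraph without self-loops, with injectively labelled
vertex subset `S ⊆ V(G)`) and every H-reducible edge `{x, y}` with `x, y ∉ S`,
the diagram of `G` is at most `C` times the diagram of the H-reduction of `G`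
by `{x, y}`. -/
theorem hreduction_inequality_for_diagrams
    (d : ℕ) (hd : 6 < d) (c C₀ : ℝ) (hc : 0 < c) (hcC : c ≤ C₀) :
    ∃ C : ℝ≥0∞, C ≠ ⊤ ∧
      ∀ τ : Vtx d → ℝ,
        (∀ w, 0 ≤ τ w ∧ τ w ≤ 1) →
        τ 0 = 1 →
        (∀ w, τ (-w) = τ w) →
        (∀ w : Vtx d, w ≠ 0 →
          c * (1 + znorm w) ^ (2 - (d : ℝ)) ≤ τ w ∧
          τ w ≤ C₀ * (1 + znorm w) ^ (2 - (d : ℝ))) →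
        ∀ (V : Type) (G : Multigraph V) (S : Set V) (ℓ : V → Vtx d),
          (∀ v ∈ S, v ∈ G.verts) →
          Set.InjOn ℓ S →
          (∀ v : V, G.mult s(v, v) = 0) →
          ∀ x y : V, x ∉ S → y ∉ S →
            G.HReducible x y →
            ∀ G' : Multigraph V, G.IsHReductionBy x y G' →
              Multigraph.Diag τ G S ℓ ≤ C * Multigraph.Diag τ G' S ℓ := by
  have hC₀ : 0 < C₀ := hc.trans_le hcC
  obtain ⟨B, hB, hBsum⟩ := exists_tsum_sqrtTau_cube_le d hd (max C₀ 1)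
  obtain ⟨k, hk⟩ := exists_tau_le_mul_tau_sub d (by omega) (min c 1) (max C₀ 1)
    (lt_min hc one_pos) (lt_max_of_lt_left hC₀)
  set K := ENNReal.ofReal k with hKdef
  refine ⟨1 + 4 * K * B + 12 * K ^ 2 * B ^ 2, by finiteness, ?_⟩
  intro τ h01 hτ0 hs hbd V G S ℓ _ _ hloop x y hx hy hH G' hG'
  have h0 (w : Vtx d) : 0 ≤ τ w := (h01 w).1
  have hup (w : Vtx d) : τ w ≤ max C₀ 1 * (1 + znorm w) ^ (2 - (d : ℝ)) := by
    by_cases hw : w = 0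
    · simp [hw, hτ0, znorm_zero]
    · refine (hbd w hw).2.trans (mul_le_mul_of_nonneg_right (le_max_left _ _) ?_)
      exact Real.rpow_nonneg (by linarith [znorm_nonneg w]) _
  have hlow (w : Vtx d) : min c 1 * (1 + znorm w) ^ (2 - (d : ℝ)) ≤ τ w := by
    by_cases hw : w = 0
    · simp [hw, hτ0, znorm_zero]
    · refine le_trans (mul_le_mul_of_nonneg_right (min_le_left _ _) ?_) (hbd w hw).1
      exact Real.rpow_nonneg (by linarith [znorm_nonneg w]) _
  have hU (w : Vtx d) : sqrtTau τ w ≤ 1 :=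
    ENNReal.ofReal_le_one.2 (Real.sqrt_le_one.2 (h01 w).2)
  have hK (a b : Vtx d) : sqrtTau τ a ^ 2 * sqrtTau τ b ^ 2 ≤
      K * sqrtTau τ (a - b) ^ 2 * (sqrtTau τ a ^ 2 + sqrtTau τ b ^ 2) := by
    simp only [sqrtTau_sq h0, hKdef, ← ENNReal.ofReal_mul' (h0 (a - b))]
    rw [mul_add]
    rcases hk τ hlow hup a b with h | h
    · exact le_add_left (mul_le_mul' (ENNReal.ofReal_le_ofReal h) le_rfl)
    · rw [mul_comm]
      exact le_add_right (mul_le_mul' (ENNReal.ofReal_le_ofReal h) le_rfl)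
  have hsum := hBsum τ h0 hup
  obtain ⟨⟨hxV, hyV, hxy, hone, -, -⟩, h | h | h | h⟩ := hG'
  · obtain ⟨-, -, z₁, z₂, t₁, t₂, hnx, hny, hverts, hmult⟩ := h
    refine (Multigraph.diag_le_of_two_vertices_erased h0 hs hK ℓ hxV hyV hx hy hxy hone hloop
      hnx hny hverts hmult).trans (mul_le_mul' ?_ le_rfl)
    exact le_add_left (by gcongr)
  · obtain ⟨-, -, z₁, z₂, hn, hverts, hmult⟩ := h
    refine (Multigraph.diag_le_of_vertex_erased h0 hs hU hK ℓ hxV hx (hloop x) hn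
      hverts hmult).trans (mul_le_mul' ?_ le_rfl)
    exact le_add_right (le_add_left (by gcongr))
  · obtain ⟨-, -, t₁, t₂, hn, hverts, hmult⟩ := h
    refine (Multigraph.diag_le_of_vertex_erased h0 hs hU hK ℓ hyV hy (hloop y) hn
      hverts hmult).trans (mul_le_mul' ?_ le_rfl)
    exact le_add_right (le_add_left (by gcongr))
  · obtain ⟨-, -, hverts, hmult⟩ := h
    refine (Multigraph.diag_le_of_edge_removed h0 hs hU S ℓ hverts hmult).trans ?_
    refine le_of_eq_of_le (one_mul _).symm (mul_le_mul' ?_ le_rfl)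
    exact le_add_right (le_add_right le_rfl)
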